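/- Assume hypothesis (H) and that k is hilbertian. Then for every positive integer d, every finite set 𝐟 of irreducible polynomials in k[z,y] ∖ k[z], and every nonzero g ∈ k[z], the set ℋ_D(d,𝐟,g) is dense in the Zariski topology on Hom_k(D,k̄). -/

import Mathlib

set_option linter.unusedSectionVars false
set_option linter.unusedVariables false

set_option linter.unusedSectionVars false
set_option linter.unusedVariables false

/-- A field `k`, with algebraic closure `k̄`, is *hilbertian* if: for every finite extension
`k̃` of `k` inside `k̄`, every `m ≥ 1`, every finite set of polynomials
`f ∈ k[t₁,…,t_m][y]`, each of positive degree in `y` and irreducible over `k̃(t₁,…,t_m)`,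
and every nonzero `g ∈ k[t₁,…,t_m]`, there is `c ∈ k^m` with `g(c) ≠ 0` such that each
`f(c,y)` is irreducible in `k̃[y]`. -/
def IsHilbertian (k kbar : Type*) [Field k] [Field kbar] [Algebra k kbar] : Prop :=
  ∀ kt : IntermediateField k kbar, FiniteDimensional k kt →
  ∀ m : ℕ, 0 < m →
  ∀ fs : Finset (Polynomial (MvPolynomial (Fin m) k)),
    (∀ f ∈ fs, 0 < f.natDegree ∧
      Irreducible (f.map ((algebraMap (MvPolynomial (Fin m) kt)
          (FractionRing (MvPolynomial (Fin m) kt))).comp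
        (MvPolynomial.map (algebraMap k kt))))) →
  ∀ g : MvPolynomial (Fin m) k, g ≠ 0 →
    ∃ c : Fin m → k, MvPolynomial.eval c g ≠ 0 ∧
      ∀ f ∈ fs, Irreducible (f.map ((algebraMap k kt).comp (MvPolynomial.eval c)))

set_option linter.unusedSectionVars false
set_option linter.unusedVariables false

section Base

variable {Ω : Type*} [Field Ω] [IsAlgClosed Ω] [CharZero Ω]
variable (k : Type*) [Field k] [Algebra k Ω]
variable (kbar : Type*) [Field kbar] [Algebra k kbar] [IsAlgClosure k kbar]

/-- `Γ` is (the carrier set of) a finitely generated subgroup of the additive group `(Ω,+)`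
or of the multiplicative group `(Ω∖{0},·)`. -/
def IsFGAddOrMulSubgroup (Γ : Set Ω) : Prop :=
  (∃ H : AddSubgroup Ω, H.FG ∧ Γ = (H : Set Ω)) ∨
  (∃ H : Subgroup Ωˣ, H.FG ∧ Γ = Units.val '' (H : Set Ωˣ))

/-- The `D`-subalgebra `D[Γ]` of `Ω` generated by `Γ`. -/
def algAdj (D : Subalgebra k Ω) (Γ : Set Ω) : Subalgebra k Ω :=
  Algebra.adjoin k ((D : Set Ω) ∪ Γ)

theorem le_algAdj (D : Subalgebra k Ω) (Γ : Set Ω) : D ≤ algAdj k D Γ :=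
  fun _ hx => Algebra.subset_adjoin (Set.mem_union_left _ hx)

theorem subset_algAdj (D : Subalgebra k Ω) (Γ : Set Ω) :
    Γ ⊆ (algAdj k D Γ : Set Ω) :=
  fun _ hx => Algebra.subset_adjoin (Set.mem_union_right _ hx)

/-- `ℬ(D,Γ)`: restrictions to `D` of the `k`-homomorphisms `D[Γ] → k̄` injective on `Γ`. -/
def specB (D : Subalgebra k Ω) (Γ : Set Ω) : Set (↥D →ₐ[k] kbar) :=
  { φ | ∃ ψ : ↥(algAdj k D Γ) →ₐ[k] kbar,
      (∀ (a b : Ω) (ha : a ∈ Γ) (hb : b ∈ Γ),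
        ψ ⟨a, subset_algAdj k D Γ ha⟩ = ψ ⟨b, subset_algAdj k D Γ hb⟩ → a = b) ∧
      ψ.comp (Subalgebra.inclusion (le_algAdj k D Γ)) = φ }

/-- A basic open subset of `Hom_k(D,k̄)`: a finite intersection of sets `ℬ(D,Γ)`. -/
def IsBasicOpen (D : Subalgebra k Ω) (U : Set (↥D →ₐ[k] kbar)) : Prop :=
  ∃ s : Finset (Set Ω), s.Nonempty ∧ (∀ Γ ∈ s, IsFGAddOrMulSubgroup Γ) ∧
    U = ⋂ Γ ∈ s, specB k kbar D Γ

/-- The Zariski closed subset `𝒱(I)` of `Hom_k(D,k̄)`. -/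
def specV (D : Subalgebra k Ω) (I : Ideal ↥D) : Set (↥D →ₐ[k] kbar) :=
  { φ | ∀ a ∈ I, φ a = 0 }

/-- Density in the Zariski topology on `Hom_k(D,k̄)` (whose closed sets are the `𝒱(I)`). -/
def ZariskiDense (D : Subalgebra k Ω) (U : Set (↥D →ₐ[k] kbar)) : Prop :=
  ∀ I : Ideal ↥D, U ⊆ specV k kbar D I → specV k kbar D I = Set.univ

end Base

section HypH

variable {Ω : Type*} [Field Ω] [IsAlgClosed Ω] [CharZero Ω]
variable (k : Type*) [Field k] [Algebra k Ω]
variable (kbar : Type*) [Field kbar] [Algebra k kbar] [IsAlgClosure k kbar]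
variable {m : ℕ} (z : Fin m → Ω) (δ : MvPolynomial (Fin m) k) (η : Ω)

/-- The algebra `D = k[z, 1/δ(z), η]` of hypothesis (H). -/
noncomputable def Dalg : Subalgebra k Ω :=
  Algebra.adjoin k (Set.range z ∪ {(MvPolynomial.aeval z δ)⁻¹, η})

theorem z_mem (i : Fin m) : z i ∈ Dalg k z δ η :=
  Algebra.subset_adjoin (Set.mem_union_left _ ⟨i, rfl⟩)

theorem aeval_mem (g : MvPolynomial (Fin m) k) :
    MvPolynomial.aeval z g ∈ Dalg k z δ η := by
  have h : MvPolynomial.aeval z g ∈ Algebra.adjoin k (Set.range z) := by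
    rw [Algebra.adjoin_range_eq_range_aeval]
    exact ⟨g, rfl⟩
  exact Algebra.adjoin_mono Set.subset_union_left h

/-- For `φ ∈ Hom_k(D,k̄)`, the polynomial `f(φ(z₁),…,φ(z_m),y)` with coefficients in the
subfield `k(φ(z₁),…,φ(z_m))` of `k̄`, obtained from `f ∈ k[z₁,…,z_m][y]`. -/
noncomputable def specPoly (φ : ↥(Dalg k z δ η) →ₐ[k] kbar)
    (f : Polynomial (MvPolynomial (Fin m) k)) :
    Polynomial ↥(IntermediateField.adjoin k
      (Set.range fun i => φ ⟨z i, z_mem k z δ η i⟩)) :=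
  f.map (MvPolynomial.aeval fun i =>
    (⟨φ ⟨z i, z_mem k z δ η i⟩,
      IntermediateField.subset_adjoin k _ ⟨i, rfl⟩⟩ :
      ↥(IntermediateField.adjoin k
        (Set.range fun i => φ ⟨z i, z_mem k z δ η i⟩)))).toRingHom

/-- The set `ℋ_D(d,𝐟,g)` of specializations. -/
noncomputable def Hset (d : ℕ) (fs : Finset (Polynomial (MvPolynomial (Fin m) k)))
    (g : MvPolynomial (Fin m) k) : Set (↥(Dalg k z δ η) →ₐ[k] kbar) :=
  { φ | φ ⟨MvPolynomial.aeval z g, aeval_mem k z δ η g⟩ ≠ 0 ∧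
    (∀ i : Fin m, Module.finrank k
      ↥(IntermediateField.adjoin k
        ((fun j => φ ⟨z j, z_mem k z δ η j⟩) '' { j : Fin m | j ≤ i })) = d ^ ((i : ℕ) + 1)) ∧
    ∀ f ∈ fs, 0 < (specPoly k kbar z δ η φ f).natDegree ∧
      Irreducible (specPoly k kbar z δ η φ f) }

end HypH

theorem RingHom.IsIntegral.exists_map_eq_mul {T A : Type*} [CommRing T] [Nontrivial T]
    [CommRing A] [IsDomain A] {φ : T →+* A} (hφ : φ.IsIntegral) {s : A} (hs : s ≠ 0) :
    ∃ (t : T) (q : A), t ≠ 0 ∧ φ t = q * s := by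
  algebraize [φ]
  have h := Ideal.comap_ne_bot_of_integral_mem (R := T) (I := Ideal.span {s}) hs
    (Ideal.mem_span_singleton_self s) (hφ s)
  obtain ⟨t, ht, ht0⟩ := Submodule.exists_mem_ne_zero_of_ne_bot h
  obtain ⟨q, hq⟩ := Ideal.mem_span_singleton'.1 (Ideal.mem_comap.1 ht)
  exact ⟨t, q, ht0, hq.symm⟩

open Polynomial in
theorem exists_irreducible_of_finite_extension {T A ι : Type*} [CommRing T] [IsDomain T]
    [CharZero T] [CommRing A] [IsDomain A] [IsGCDMonoid A] [Fintype ι] (φ : T →+* A)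
    (hφ : Function.Injective φ) (hfin : φ.Finite) (e : ι → A)
    (he : ∀ c : ι → T, ∑ i, φ (c i) * e i = 0 → ∀ i, c i = 0)
    (f : A[X]) (hf : Irreducible f) (hdeg : 0 < f.natDegree) :
    ∃ (p : T[X]) (r : A[X]), Irreducible (p.map (algebraMap T (FractionRing T))) ∧
      Fintype.card ι * f.natDegree ≤ p.natDegree ∧
      f ∣ p.eval₂ (C.comp φ) r := by
  algebraize [φ]
  have : FaithfulSMul T A := (faithfulSMul_iff_algebraMap_injective T A).2 hφ
  have he' : LinearIndependent T e := Fintype.linearIndependent_iff.2 fun c hc =>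
    he c (by
      simp only [Algebra.smul_def] at hc
      exact hc)
  let K := FractionRing T
  let E := FractionRing A
  let : Algebra K E := FractionRing.liftAlgebra T E
  have : IsScalarTower T K E := FractionRing.isScalarTower_liftAlgebra T E
  have hprim : f.IsPrimitive := hf.isPrimitive hdeg.ne'
  have hfE : Irreducible (f.map (algebraMap A E)) :=
    hprim.irreducible_iff_irreducible_map_fraction_map.1 hf
  have hdegE : (f.map (algebraMap A E)).natDegree = f.natDegree :=
    natDegree_map_eq_of_injective (IsFractionRing.injective A E) f
  have : Fact (Irreducible (f.map (algebraMap A E))) := ⟨hfE⟩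
  let L := AdjoinRoot (f.map (algebraMap A E))
  have : FiniteDimensional K E := .of_isLocalization T A (nonZeroDivisors T)
  have : FiniteDimensional E L := (AdjoinRoot.powerBasis hfE.ne_zero).finite
  have : FiniteDimensional K L := .trans K E L
  have hEL : Module.finrank E L = f.natDegree := by
    rw [(AdjoinRoot.powerBasis hfE.ne_zero).finrank, AdjoinRoot.powerBasis_dim, hdegE]
  have hKE : Fintype.card ι ≤ Module.finrank K E := by
    have h1 : LinearIndependent T (fun i => algebraMap A E (e i)) :=
      he'.map' (IsScalarTower.toAlgHom T A E).toLinearMap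
        (LinearMap.ker_eq_bot.2 (IsFractionRing.injective A E))
    exact ((LinearIndependent.iff_fractionRing T K).1 h1).fintype_card_le_finrank
  have : CharZero K := charZero_of_injective_algebraMap (IsFractionRing.injective T K)
  obtain ⟨θ₀, hθ₀⟩ := Field.exists_primitive_element K L
  obtain ⟨r₀, hr₀⟩ := AdjoinRoot.mk_surjective θ₀
  obtain ⟨s, hs, hsr⟩ := IsLocalization.integerNormalization_spec (nonZeroDivisors A) r₀
  obtain ⟨t, q, ht, hq⟩ :=
    hfin.to_isIntegral.exists_map_eq_mul (nonZeroDivisors.ne_zero hs)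
  let r : A[X] := C q * IsLocalization.integerNormalization (nonZeroDivisors A) r₀
  let θ : L := AdjoinRoot.mk _ (r.map (algebraMap A E))
  have hθ : θ = algebraMap T K t • θ₀ := by
    have : r.map (algebraMap A E) = (algebraMap K E (algebraMap T K t)) • r₀ := by
      rw [← IsScalarTower.algebraMap_apply T K E, IsScalarTower.algebraMap_apply T A E,
        show algebraMap T A t = q * s from hq]
      simp only [r, Polynomial.map_mul, map_C, hsr]
      rw [← algebraMap_smul E s r₀, smul_eq_C_mul, smul_eq_C_mul, map_mul, C_mul, mul_assoc]
    rw [← algebraMap_smul E (algebraMap T K t) θ₀, ← hr₀]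
    change AdjoinRoot.mk _ _ = _
    rw [this, AdjoinRoot.smul_mk]
  have ht' : algebraMap T K t ≠ 0 := by simpa using ht
  have hadj : IntermediateField.adjoin K {θ} = ⊤ := by
    rw [eq_top_iff, ← hθ₀, IntermediateField.adjoin_simple_le_iff]
    have := (IntermediateField.adjoin K {θ}).smul_mem
      (IntermediateField.mem_adjoin_simple_self K θ) (x := (algebraMap T K t)⁻¹)
    rwa [hθ, inv_smul_smul₀ ht', ← hθ] at this
  have hint : IsIntegral K θ := Algebra.IsIntegral.isIntegral θ
  obtain ⟨b, hb, hbp⟩ :=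
    IsLocalization.integerNormalization_spec (nonZeroDivisors T) (minpoly K θ)
  set p := IsLocalization.integerNormalization (nonZeroDivisors T) (minpoly K θ)
  have hb' : algebraMap T K b ≠ 0 := by simpa using nonZeroDivisors.ne_zero hb
  have hpm : p.map (algebraMap T K) = C (algebraMap T K b) * minpoly K θ := by
    rw [hbp, ← algebraMap_smul K b, smul_eq_C_mul]
  refine ⟨p, r, ?_, ?_, ?_⟩
  · change Irreducible (p.map (algebraMap T K))
    rw [hpm]
    exact (irreducible_isUnit_mul (isUnit_C.2 hb'.isUnit)).2 (minpoly.irreducible hint)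
  · rw [← natDegree_map_eq_of_injective (IsFractionRing.injective T K) p, hpm,
      natDegree_C_mul hb', ← IntermediateField.adjoin.finrank hint, hadj,
      IntermediateField.finrank_top', ← Module.finrank_mul_finrank K E L, hEL]
    exact Nat.mul_le_mul_right _ hKE
  · apply hprim.dvd_of_fraction_map_dvd_fraction_map (K := E)
    rw [← AdjoinRoot.mk_eq_zero]
    have h0 : (p.map (algebraMap T K)).eval₂ (algebraMap K L) θ = 0 := by
      rw [hpm, ← aeval_def]; simp
    rw [eval₂_map] at h0
    have h1 : (AdjoinRoot.mk (f.map (algebraMap A E))).comp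
        ((mapRingHom (algebraMap A E)).comp (C.comp φ)) =
        (algebraMap K L).comp (algebraMap T K) := by
      ext x
      have h2 : (mapRingHom (algebraMap A E)).comp (C.comp φ) x =
          C (algebraMap K E (algebraMap T K x)) := by
        rw [← IsScalarTower.algebraMap_apply T K E, IsScalarTower.algebraMap_apply T A E]
        exact map_C _
      rw [RingHom.comp_apply, h2]
      rfl
    rw [← h1] at h0
    change (AdjoinRoot.mk (f.map (algebraMap A E))) (mapRingHom (algebraMap A E) _) = 0
    rw [hom_eval₂, hom_eval₂]
    exact h0

namespace MvPolynomial

theorem finite_expand {σ R : Type*} [Finite σ] [CommRing R] {d : ℕ} (hd : 0 < d) :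
    (expand d : MvPolynomial σ R →ₐ[R] MvPolynomial σ R).toRingHom.Finite := by
  apply RingHom.IsIntegral.to_finite
  · intro x
    induction x using MvPolynomial.induction_on with
    | C a =>
      have := (expand d : MvPolynomial σ R →ₐ[R] MvPolynomial σ R).toRingHom.isIntegralElem_map
        (x := C a)
      simpa using this
    | add p q hp hq => exact hp.add _ hq
    | mul_X p i hp =>
      refine hp.mul _ ⟨Polynomial.X ^ d - Polynomial.C (X i),
        Polynomial.monic_X_pow_sub_C _ hd.ne', by simp⟩
  · apply RingHom.FiniteType.of_comp_finiteType (f := C)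
    have h : (expand d : MvPolynomial σ R →ₐ[R] MvPolynomial σ R).toRingHom.comp C = C := by
      ext; simp
    rw [h]
    exact RingHom.finiteType_algebraMap.2
      (inferInstanceAs (Algebra.FiniteType R (MvPolynomial σ R)))

theorem eq_zero_of_sum_expand_mul_monomial_eq_zero {σ R : Type*} [Fintype σ] [DecidableEq σ]
    [CommRing R] {d : ℕ} (hd : 0 < d) (c : (σ → Fin d) → MvPolynomial σ R)
    (hc : ∑ α, expand d (c α) * monomial (Finsupp.equivFunOnFinite.symm fun i => (α i : ℕ)) 1 = 0)
    (α : σ → Fin d) : c α = 0 := by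
  ext β
  have h := congrArg (coeff (d • β + Finsupp.equivFunOnFinite.symm fun i => (α i : ℕ))) hc
  rw [coeff_sum, Finset.sum_eq_single α] at h
  · simpa [coeff_mul_monomial, coeff_expand_smul d hd.ne'] using h
  · intro α' _ hne
    rw [coeff_mul_monomial']
    split_ifs with hle
    · obtain ⟨i, hi⟩ := Function.ne_iff.1 hne
      rw [mul_one]
      apply coeff_expand_of_not_dvd (i := i)
      have hlei := hle i
      simp at hlei ⊢
      intro hdvd
      apply hi
      have h1 : ((α' i : ℕ) : ℕ) ≡ d * β i + α i [MOD d] :=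
        (Nat.modEq_iff_dvd' hlei).2 hdvd
      have h2 : (α' i : ℕ) ≡ α i [MOD d] := h1.trans (by simp [Nat.ModEq])
      exact Fin.ext (by simpa [Nat.ModEq, Nat.mod_eq_of_lt] using h2)
    · rfl
  · simp

end MvPolynomial

namespace IntermediateField

variable {k F ι : Type*} [Field k] [Field F] [Algebra k F] {a : ι → F} {c : ι → k} {d : ℕ}

theorem finrank_adjoin_image_le (hd : 0 < d) (ha : ∀ i, a i ^ d = algebraMap k F (c i))
    (s : Finset ι) : Module.finrank k (adjoin k (a '' s)) ≤ d ^ s.card := by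
  classical
  induction s using Finset.induction_on with
  | empty =>
    rw [Finset.coe_empty, Set.image_empty, adjoin_empty]
    simp
  | insert i s hi ih =>
    have hroot : Polynomial.aeval (a i) (Polynomial.X ^ d - Polynomial.C (c i)) = 0 := by
      simp [ha]
    have hmonic := Polynomial.monic_X_pow_sub_C (c i) hd.ne'
    have hint : IsIntegral k (a i) := ⟨_, hmonic, hroot⟩
    have h1 : Module.finrank k (adjoin k {a i}) ≤ d := by
      rw [adjoin.finrank hint]
      simpa using Polynomial.natDegree_le_of_dvd (minpoly.dvd k _ hroot) hmonic.ne_zero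
    rw [Finset.coe_insert, Set.image_insert_eq, Set.insert_eq, adjoin_union,
      Finset.card_insert_of_notMem hi, pow_succ']
    exact (finrank_sup_le _ _).trans (Nat.mul_le_mul h1 ih)

theorem finrank_adjoin_image_eq [Fintype ι] (hd : 0 < d)
    (ha : ∀ i, a i ^ d = algebraMap k F (c i))
    (htop : d ^ Fintype.card ι ≤ Module.finrank k (adjoin k (Set.range a))) (s : Finset ι) :
    Module.finrank k (adjoin k (a '' s)) = d ^ s.card := by
  classical
  refine (finrank_adjoin_image_le hd ha s).antisymm ?_
  have h1 : adjoin k (Set.range a) = adjoin k (a '' s) ⊔ adjoin k (a '' (sᶜ : Finset ι)) := by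
    rw [← adjoin_union, ← Set.image_union, ← Finset.coe_union, Finset.union_compl,
      Finset.coe_univ, Set.image_univ]
  have h2 := htop.trans_eq (by rw [h1])
  have h3 := (h2.trans (finrank_sup_le _ _)).trans
    (Nat.mul_le_mul_left _ (finrank_adjoin_image_le hd ha sᶜ))
  rw [← Finset.card_add_card_compl s, pow_add] at h3
  exact Nat.le_of_mul_le_mul_right h3 (pow_pos hd _)

end IntermediateField

open Polynomial in
theorem irreducible_map_of_irreducible_map_eval {k K ι : Type*} [Field k] [Field K]
    [Algebra k K] [FiniteDimensional k K] [Fintype ι] {c : ι → k} {d : ℕ} (hd : 0 < d)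
    (hK : Module.finrank k K ≤ d ^ Fintype.card ι) (ψ : MvPolynomial ι k →ₐ[k] K)
    (hψ : ∀ i, ψ (.X i) ^ d = algebraMap k K (c i)) {f p r : (MvPolynomial ι k)[X]}
    (hf : 0 < f.natDegree) (hψf : ψ f.leadingCoeff ≠ 0)
    (hp : Irreducible (p.map (MvPolynomial.eval c)))
    (hpc : MvPolynomial.eval c p.leadingCoeff ≠ 0)
    (hdeg : d ^ Fintype.card ι * f.natDegree ≤ p.natDegree)
    (hdvd : f ∣ p.eval₂ (C.comp (MvPolynomial.expand d).toRingHom) r) :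
    Module.finrank k K = d ^ Fintype.card ι ∧
      (f.map ψ.toRingHom).natDegree = f.natDegree ∧ Irreducible (f.map ψ.toRingHom) := by
  have hdegf : (f.map ψ.toRingHom).natDegree = f.natDegree :=
    natDegree_map_of_leadingCoeff_ne_zero _ hψf
  have hfK0 : f.map ψ.toRingHom ≠ 0 := ne_zero_of_natDegree_gt (hdegf ▸ hf)
  have hunit : ¬ IsUnit (f.map ψ.toRingHom) := fun h => by
    have := natDegree_eq_zero_of_isUnit h
    omega
  obtain ⟨q, hq, hqf⟩ := WfDvdMonoid.exists_irreducible_factor hunit hfK0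
  have : Fact (Irreducible q) := ⟨hq⟩
  let N := AdjoinRoot q
  have : FiniteDimensional K N := (AdjoinRoot.powerBasis hq.ne_zero).finite
  have : FiniteDimensional k N := .trans k K N
  have hN : Module.finrank K N = q.natDegree := by
    rw [(AdjoinRoot.powerBasis hq.ne_zero).finrank, AdjoinRoot.powerBasis_dim]
  let ev : (MvPolynomial ι k)[X] →+* N :=
    (AdjoinRoot.mk q).comp (mapRingHom ψ.toRingHom)
  have hevf : ev f = 0 := AdjoinRoot.mk_eq_zero.2 hqf
  have hev : ev.comp (C.comp (MvPolynomial.expand d).toRingHom) =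
      (algebraMap k N).comp (MvPolynomial.eval c) := by
    have h1 : ψ.comp (MvPolynomial.expand d) =
        (Algebra.ofId k K).comp (MvPolynomial.aeval c) :=
      MvPolynomial.algHom_ext fun i => by simp [hψ, Algebra.ofId_apply]
    refine RingHom.ext fun x => ?_
    have h2 : ψ (MvPolynomial.expand d x) = algebraMap k K (MvPolynomial.eval c x) :=
      DFunLike.congr_fun h1 x
    change AdjoinRoot.mk q (Polynomial.map _ (C _)) = _
    rw [map_C]
    exact congrArg (AdjoinRoot.of q) h2
  have hroot : aeval (ev r) (p.map (MvPolynomial.eval c)) = 0 := by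
    rw [aeval_def, eval₂_map, ← hev, ← hom_eval₂]
    obtain ⟨s, hs⟩ := hdvd
    rw [hs, map_mul, hevf, zero_mul]
  have hmin : (minpoly k (ev r)).natDegree = p.natDegree := by
    rw [← minpoly.eq_of_irreducible hp hroot, natDegree_mul_C (by simpa using hp.ne_zero)]
    exact natDegree_map_of_leadingCoeff_ne_zero _ hpc
  have hle : d ^ Fintype.card ι * f.natDegree ≤ Module.finrank k K * q.natDegree := by
    rw [← hN, Module.finrank_mul_finrank]
    exact (hdeg.trans hmin.ge).trans (minpoly.natDegree_le _)
  have hqle : q.natDegree ≤ f.natDegree := hdegf ▸ natDegree_le_of_dvd hqf hfK0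
  have hKeq : Module.finrank k K = d ^ Fintype.card ι := hK.antisymm <|
    Nat.le_of_mul_le_mul_right (hle.trans (Nat.mul_le_mul_left _ hqle)) hf
  refine ⟨hKeq, hdegf, ?_⟩
  rw [hKeq] at hle
  have hqge := Nat.le_of_mul_le_mul_left hle (pow_pos hd _)
  exact (associated_of_dvd_of_natDegree_le hqf hfK0 (by omega)).irreducible hq

theorem IsHilbertian.exists_irreducible_map_eval {k kbar : Type*} [Field k] [Field kbar]
    [Algebra k kbar] (hk : IsHilbertian k kbar) {m : ℕ} (hm : 0 < m)
    (ps : Finset (Polynomial (MvPolynomial (Fin m) k)))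
    (hps : ∀ p ∈ ps, 0 < p.natDegree ∧
      Irreducible (p.map (algebraMap _ (FractionRing (MvPolynomial (Fin m) k)))))
    (g : MvPolynomial (Fin m) k) (hg : g ≠ 0) :
    ∃ c : Fin m → k, MvPolynomial.eval c g ≠ 0 ∧
      ∀ p ∈ ps, Irreducible (p.map (MvPolynomial.eval c)) := by
  let e : k ≃+* (⊥ : IntermediateField k kbar) :=
    (IntermediateField.botEquiv k kbar).symm.toRingEquiv
  have he : (e : k →+* _) = algebraMap k (⊥ : IntermediateField k kbar) := by
    ext x
    simp [e]
  let eM : MvPolynomial (Fin m) k ≃+* MvPolynomial (Fin m) (⊥ : IntermediateField k kbar) :=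
    MvPolynomial.mapEquiv (Fin m) e
  let eF : FractionRing (MvPolynomial (Fin m) k) ≃+*
      FractionRing (MvPolynomial (Fin m) (⊥ : IntermediateField k kbar)) :=
    IsFractionRing.ringEquivOfRingEquiv eM
  have heF : (algebraMap (MvPolynomial (Fin m) (⊥ : IntermediateField k kbar))
      (FractionRing (MvPolynomial (Fin m) (⊥ : IntermediateField k kbar)))).comp
        (MvPolynomial.map (algebraMap k (⊥ : IntermediateField k kbar))) =
      eF.toRingHom.comp (algebraMap _ _) := by
    refine RingHom.ext fun x => ?_
    have : eF (algebraMap _ _ x) = algebraMap _ _ (eM x) :=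
      IsFractionRing.ringEquivOfRingEquiv_algebraMap eM x
    rw [← he]
    exact this.symm
  obtain ⟨c, hcg, hc⟩ := hk ⊥ inferInstance m hm ps (fun p hp => by
    refine ⟨(hps p hp).1, ?_⟩
    rw [heF, ← Polynomial.map_map]
    exact (MulEquiv.irreducible_iff (Polynomial.mapEquiv eF)).2 (hps p hp).2) g hg
  refine ⟨c, hcg, fun p hp => ?_⟩
  have := hc p hp
  rw [← he, ← Polynomial.map_map] at this
  exact (MulEquiv.irreducible_iff (Polynomial.mapEquiv e)).1 this

theorem IsHilbertian.exists_adjoin_finrank_eq_and_irreducible {k kbar : Type*} [Field k]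
    [CharZero k] [Field kbar] [Algebra k kbar] [IsAlgClosed kbar] (hk : IsHilbertian k kbar)
    {m : ℕ} (hm : 0 < m) {d : ℕ} (hd : 0 < d)
    (fs : Finset (Polynomial (MvPolynomial (Fin m) k)))
    (hfs : ∀ f ∈ fs, Irreducible f ∧ 0 < f.natDegree)
    (g : MvPolynomial (Fin m) k) (hg : g ≠ 0) :
    ∃ a : Fin m → kbar, MvPolynomial.aeval a g ≠ 0 ∧
      (∀ s : Finset (Fin m),
        Module.finrank k (IntermediateField.adjoin k (a '' s)) = d ^ s.card) ∧
      ∀ f ∈ fs, ∀ ψ : MvPolynomial (Fin m) k →ₐ[k] IntermediateField.adjoin k (Set.range a),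
        (∀ i, (ψ (.X i) : kbar) = a i) →
        0 < (f.map ψ.toRingHom).natDegree ∧ Irreducible (f.map ψ.toRingHom) := by
  classical
  have : IsGCDMonoid (MvPolynomial (Fin m) k) :=
    ⟨UniqueFactorizationMonoid.toGCDMonoid _⟩
  have hexp := MvPolynomial.finite_expand (σ := Fin m) (R := k) hd
  have hinj : Function.Injective
      (MvPolynomial.expand d : MvPolynomial (Fin m) k →ₐ[k] _).toRingHom :=
    MvPolynomial.expand_injective hd
  -- `X` is added so that the degree statement also holds when `fs` is empty.
  set fs' := insert Polynomial.X fs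
  have hfs' : ∀ f ∈ fs', Irreducible f ∧ 0 < f.natDegree := fun f hf => by
    rcases Finset.mem_insert.1 hf with rfl | hf
    · exact ⟨Polynomial.irreducible_X, by simp⟩
    · exact hfs f hf
  have key (f : fs') := exists_irreducible_of_finite_extension
    (MvPolynomial.expand d : MvPolynomial (Fin m) k →ₐ[k] _).toRingHom hinj hexp
    (fun α : Fin m → Fin d =>
      MvPolynomial.monomial (Finsupp.equivFunOnFinite.symm fun i => (α i : ℕ)) (1 : k))
    (MvPolynomial.eq_zero_of_sum_expand_mul_monomial_eq_zero hd) f.1 (hfs' f.1 f.2).1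
    (hfs' f.1 f.2).2
  choose p r hp hpdeg hpdvd using key
  simp only [Fintype.card_fun, Fintype.card_fin] at hpdeg
  have hppos (f : fs') : 0 < (p f).natDegree :=
    (Nat.mul_pos (pow_pos hd _) (hfs' f.1 f.2).2).trans_le (hpdeg f)
  have hlc (f : fs') := hexp.to_isIntegral.exists_map_eq_mul
    (Polynomial.leadingCoeff_ne_zero.2 (hfs' f.1 f.2).1.ne_zero)
  choose t q ht hq using hlc
  obtain ⟨t₀, q₀, ht₀, hq₀⟩ := hexp.to_isIntegral.exists_map_eq_mul hg
  obtain ⟨c, hcg, hc⟩ := hk.exists_irreducible_map_eval hm (Finset.univ.image p)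
    (by simpa only [Finset.forall_mem_image] using fun f _ => ⟨hppos f, hp f⟩)
    (t₀ * ∏ f, (t f * (p f).leadingCoeff))
    (mul_ne_zero ht₀ (Finset.prod_ne_zero_iff.2 fun f _ => mul_ne_zero (ht f)
      (Polynomial.leadingCoeff_ne_zero.2 (Polynomial.ne_zero_of_natDegree_gt (hppos f)))))
  rw [map_mul, map_prod] at hcg
  have hct (f : fs') : MvPolynomial.eval c (t f * (p f).leadingCoeff) ≠ 0 :=
    Finset.prod_ne_zero_iff.1 (right_ne_zero_of_mul hcg) f (Finset.mem_univ f)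
  choose a ha using fun i => IsAlgClosed.exists_pow_nat_eq (algebraMap k kbar (c i)) hd
  have haeval (h : MvPolynomial (Fin m) k) :
      MvPolynomial.aeval a (MvPolynomial.expand d h) =
        algebraMap k kbar (MvPolynomial.eval c h) := by
    have : (MvPolynomial.aeval a).comp (MvPolynomial.expand d) =
        (Algebra.ofId k kbar).comp (MvPolynomial.aeval c) :=
      MvPolynomial.algHom_ext fun i => by simp [ha, Algebra.ofId_apply]
    exact DFunLike.congr_fun this h
  have hne {u v w : MvPolynomial (Fin m) k}
      (h : (MvPolynomial.expand d : MvPolynomial (Fin m) k →ₐ[k] _).toRingHom u = w * v)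
      (hu : MvPolynomial.eval c u ≠ 0) : MvPolynomial.aeval a v ≠ 0 := fun hv => by
    have h1 := haeval u
    rw [show MvPolynomial.expand d u = w * v from h, map_mul, hv, mul_zero] at h1
    exact hu ((map_eq_zero _).1 h1.symm)
  have hint (i : Fin m) : IsIntegral k (a i) :=
    ⟨_, Polynomial.monic_X_pow_sub_C (c i) hd.ne', by simp [ha]⟩
  let K := IntermediateField.adjoin k (Set.range a)
  have hKfin : FiniteDimensional k K :=
    IntermediateField.finiteDimensional_adjoin (by rintro _ ⟨i, rfl⟩; exact hint i)
  have hKle : Module.finrank k K ≤ d ^ Fintype.card (Fin m) := by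
    have := IntermediateField.finrank_adjoin_image_le hd ha Finset.univ
    rwa [Finset.coe_univ, Set.image_univ] at this
  have main (f : fs') (ψ : MvPolynomial (Fin m) k →ₐ[k] K) (hψ : ∀ i, (ψ (.X i) : kbar) = a i) :=
    irreducible_map_of_irreducible_map_eval (c := c) hd hKle ψ
      (fun i => Subtype.ext (by simpa [hψ] using ha i)) (hfs' f.1 f.2).2
      (fun h => by
        have h1 : K.val.comp ψ = MvPolynomial.aeval a :=
          MvPolynomial.algHom_ext fun i => by simpa using hψ i
        apply hne (hq f) (by simpa using left_ne_zero_of_mul (by simpa using hct f))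
        rw [← h1, AlgHom.comp_apply, h, map_zero])
      (hc _ (Finset.mem_image_of_mem p (Finset.mem_univ f)))
      (fun h => hct f (by simp [h])) (by simpa using hpdeg f) (hpdvd f)
  refine ⟨a, hne hq₀ (left_ne_zero_of_mul hcg), fun s => ?_, fun f hf ψ hψ => ?_⟩
  · have h1 := (main ⟨Polynomial.X, Finset.mem_insert_self _ _⟩ (MvPolynomial.aeval fun i =>
      ⟨a i, IntermediateField.subset_adjoin k _ ⟨i, rfl⟩⟩) (by simp)).1
    exact IntermediateField.finrank_adjoin_image_eq hd ha h1.ge s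
  · obtain ⟨-, h1, h2⟩ := main ⟨f, Finset.mem_insert_of_mem hf⟩ ψ hψ
    exact ⟨h1 ▸ (hfs f hf).2, h2⟩

theorem IsAlgClosed.exists_ringHom_comp_eq_of_isIntegral {R S F : Type*} [CommRing R] [CommRing S]
    [Field F] [IsAlgClosed F] {j : R →+* S} (hj : Function.Injective j) (hint : j.IsIntegral)
    (φ : R →+* F) : ∃ χ : S →+* F, χ.comp j = φ := by
  algebraize [j]
  let P := RingHom.ker φ
  have hP : P.IsPrime := RingHom.ker_isPrime φ
  obtain ⟨Q, -, hQ, hQP⟩ := Ideal.exists_ideal_over_prime_of_isIntegral P (⊥ : Ideal S) (by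
    rw [← RingHom.ker_eq_comap_bot, (RingHom.injective_iff_ker_eq_bot (algebraMap R S)).1 hj]
    exact bot_le)
  have : Q.LiesOver P := ⟨hQP.symm⟩
  algebraize [RingHom.kerLift φ]
  have : Module.IsTorsionFree (R ⧸ P) F :=
    Module.isTorsionFree_iff_algebraMap_injective.2 (RingHom.kerLift_injective φ)
  have : Module.IsTorsionFree (R ⧸ P) (S ⧸ Q) :=
    Module.isTorsionFree_iff_algebraMap_injective.2 (FaithfulSMul.algebraMap_injective _ _)
  let χ : (S ⧸ Q) →ₐ[R ⧸ P] F := IsAlgClosed.lift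
  refine ⟨χ.toRingHom.comp (Ideal.Quotient.mk Q), RingHom.ext fun x => ?_⟩
  exact χ.commutes (Ideal.Quotient.mk P x)

section HypothesisH

variable {Ω : Type*} [Field Ω] {k : Type*} [Field k] [Algebra k Ω] {m : ℕ} {z : Fin m → Ω}
  {δ : MvPolynomial (Fin m) k} {η : Ω}

/-- The inclusion of `k[z, 1/δ(z)]` in `D`. -/
theorem exists_algHom_localizationAway_Dalg [IsAlgClosed Ω] [CharZero Ω]
    (hz : AlgebraicIndependent k z) (hδ : δ ≠ 0)
    (hη : IsIntegral ↥(Algebra.adjoin k (Set.range z ∪ {(MvPolynomial.aeval z δ)⁻¹})) η) :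
    ∃ j : Localization.Away δ →ₐ[k] Dalg k z δ η, Function.Injective j ∧
      j.toRingHom.IsIntegral ∧
      ∀ h, j (algebraMap _ _ h) = ⟨MvPolynomial.aeval z h, aeval_mem k z δ η h⟩ := by
  let F : MvPolynomial (Fin m) k →ₐ[k] Dalg k z δ η :=
    (MvPolynomial.aeval z).codRestrict _ (aeval_mem k z δ η)
  have hF : Function.Injective F := fun x y hxy => hz (congrArg Subtype.val hxy)
  have hδz : MvPolynomial.aeval z δ ≠ 0 := fun h => hδ (hz (by simpa using h))
  have hδmem : (MvPolynomial.aeval z δ)⁻¹ ∈ Dalg k z δ η :=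
    Algebra.subset_adjoin (Set.mem_union_right _ (Set.mem_insert _ _))
  have hunit : ∀ y : Submonoid.powers δ, IsUnit (F y) := by
    rintro ⟨_, n, rfl⟩
    simp only [map_pow]
    exact (IsUnit.of_mul_eq_one ⟨_, hδmem⟩ (Subtype.ext (mul_inv_cancel₀ hδz))).pow n
  let j : Localization.Away δ →ₐ[k] Dalg k z δ η := IsLocalization.liftAlgHom hunit
  have hj (h) : j (algebraMap _ _ h) = ⟨MvPolynomial.aeval z h, aeval_mem k z δ η h⟩ :=
    IsLocalization.lift_eq hunit h
  have hinj : Function.Injective j :=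
    (IsLocalization.lift_injective_iff hunit).2 fun x y => by
      rw [(IsLocalization.injective (Localization.Away δ)
        (powers_le_nonZeroDivisors_of_noZeroDivisors hδ)).eq_iff]
      exact hF.eq_iff.symm
  refine ⟨j, hinj, ?_, hj⟩
  let J : Localization.Away δ →ₐ[k] Ω := (Dalg k z δ η).val.comp j
  have hBJ : Algebra.adjoin k (Set.range z ∪ {(MvPolynomial.aeval z δ)⁻¹}) ≤ J.range := by
    refine Algebra.adjoin_le (Set.union_subset ?_ ?_)
    · rintro _ ⟨i, rfl⟩
      exact ⟨algebraMap (MvPolynomial (Fin m) k) _ (.X i), by simp [J, hj]⟩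
    · rintro _ rfl
      refine ⟨IsLocalization.Away.invSelf δ, eq_inv_of_mul_eq_one_right ?_⟩
      have := congrArg J (IsLocalization.Away.mul_invSelf (S := Localization.Away δ) δ)
      rw [map_mul, map_one] at this
      rwa [show J (algebraMap _ _ δ) = MvPolynomial.aeval z δ by simp [J, hj]] at this
  algebraize [J.toRingHom]
  have hηJ : IsIntegral (Localization.Away δ) η := by
    obtain ⟨p, hp, hpη⟩ := hη
    obtain ⟨q, hq, -, hqm⟩ := Polynomial.lifts_and_natDegree_eq_and_monic
      (f := J.toRingHom) (p := p.map (algebraMap _ Ω))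
      ((Polynomial.lifts_iff_coeff_lifts _).2 fun n => by
        rw [Polynomial.coeff_map]
        exact hBJ (p.coeff n).2) (hp.map _)
    refine ⟨q, hqm, ?_⟩
    have := congrArg (Polynomial.eval η) hq
    rwa [Polynomial.eval_map, Polynomial.eval_map, hpη] at this
  have hk : IsScalarTower k (Localization.Away δ) Ω :=
    .of_algebraMap_eq fun x => (J.commutes x).symm
  have hD : Dalg k z δ η ≤ (integralClosure (Localization.Away δ) Ω).restrictScalars k := by
    have hB : ∀ x ∈ Set.range z ∪ {(MvPolynomial.aeval z δ)⁻¹},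
        IsIntegral (Localization.Away δ) x := fun x hx => by
      obtain ⟨y, rfl⟩ := hBJ (Algebra.subset_adjoin hx)
      exact isIntegral_algebraMap (x := y)
    refine Algebra.adjoin_le (Set.union_subset (fun x hx => hB x (.inl hx)) ?_)
    rintro _ (rfl | rfl)
    · exact hB _ (.inr rfl)
    · exact hηJ
  intro x
  obtain ⟨p, hp, hpx⟩ := hD x.2
  refine ⟨p, hp, Subtype.val_injective ?_⟩
  have := Polynomial.hom_eval₂ p j.toRingHom (Dalg k z δ η).val.toRingHom x
  exact this.trans hpx

end HypothesisH

/-- Corollary 2.10 of the paper. Under hypothesis (H), if `k` is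
hilbertian then `ℋ_D(d,𝐟,g)` is Zariski dense in `Hom_k(D,k̄)`. -/
theorem Hset_zariskiDense
    {Ω : Type*} [Field Ω] [IsAlgClosed Ω] [CharZero Ω]
    (k : Type*) [Field k] [Algebra k Ω]
    (kbar : Type*) [Field kbar] [Algebra k kbar] [IsAlgClosure k kbar]
    {m : ℕ} (z : Fin m → Ω) (δ : MvPolynomial (Fin m) k) (η : Ω)
    -- hypothesis (H)
    (hm : 0 < m) (hz : AlgebraicIndependent k z) (hδ : δ ≠ 0)
    (hη : IsIntegral ↥(Algebra.adjoin k (Set.range z ∪ {(MvPolynomial.aeval z δ)⁻¹})) η)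
    -- `k` is hilbertian
    (hk : IsHilbertian k kbar)
    (d : ℕ) (hd : 0 < d)
    (fs : Finset (Polynomial (MvPolynomial (Fin m) k)))
    (hfs : ∀ f ∈ fs, Irreducible f ∧ 0 < f.natDegree)
    (g : MvPolynomial (Fin m) k) (hg : g ≠ 0) :
    ZariskiDense k kbar (Dalg k z δ η) (Hset k kbar z δ η d fs g) := by
  have : CharZero k := (algebraMap k Ω).charZero_iff (algebraMap k Ω).injective |>.2 inferInstance
  have : IsAlgClosed kbar := IsAlgClosure.isAlgClosed k
  obtain ⟨j, hinj, hint, hj⟩ := exists_algHom_localizationAway_Dalg hz hδ hη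
  intro I hI
  by_cases hbot : I = ⊥
  · subst hbot
    refine Set.eq_univ_of_forall fun φ a ha => ?_
    rw [Ideal.mem_bot.1 ha, map_zero]
  exfalso
  obtain ⟨h, hh, hhI⟩ : ∃ h : MvPolynomial (Fin m) k, h ≠ 0 ∧
      (⟨MvPolynomial.aeval z h, aeval_mem k z δ η h⟩ : Dalg k z δ η) ∈ I := by
    obtain ⟨x, hx, hx0⟩ := Submodule.exists_mem_ne_zero_of_ne_bot hbot
    have : Nontrivial (Localization.Away δ) := j.domain_nontrivial
    obtain ⟨t, q, ht, hq⟩ := hint.exists_map_eq_mul hx0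
    obtain ⟨h, s, rfl⟩ := IsLocalization.exists_mk'_eq (Submonoid.powers δ) t
    refine ⟨h, fun h0 => ht (by rw [h0, IsLocalization.mk'_zero]), ?_⟩
    rw [← hj, ← IsLocalization.mk'_spec (Localization.Away δ) h s, map_mul]
    exact I.mul_mem_right _ ((show j _ = q * x from hq) ▸ I.mul_mem_left q hx)
  obtain ⟨a, hga, hfin, hirr⟩ := hk.exists_adjoin_finrank_eq_and_irreducible hm hd fs hfs
    (g * h * δ) (mul_ne_zero (mul_ne_zero hg hh) hδ)
  simp only [map_mul, ne_eq, mul_eq_zero, not_or] at hga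
  obtain ⟨⟨hga, hha⟩, hδa⟩ := hga
  have hunit : ∀ y : Submonoid.powers δ,
      IsUnit ((MvPolynomial.aeval a : _ →ₐ[k] kbar) (y : MvPolynomial (Fin m) k)) := by
    rintro ⟨_, n, rfl⟩
    rw [map_pow]
    exact (isUnit_iff_ne_zero.2 hδa).pow n
  let φ₀ : Localization.Away δ →ₐ[k] kbar := IsLocalization.liftAlgHom hunit
  obtain ⟨χ, hχ⟩ := IsAlgClosed.exists_ringHom_comp_eq_of_isIntegral
    (j := j.toRingHom) hinj hint φ₀.toRingHom
  obtain ⟨φ, hφ⟩ : ∃ φ : Dalg k z δ η →ₐ[k] kbar,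
      ∀ u, φ ⟨MvPolynomial.aeval z u, aeval_mem k z δ η u⟩ = MvPolynomial.aeval a u := by
    refine ⟨{ χ with
      commutes' := fun x => by
        rw [← j.commutes, ← φ₀.commutes]
        exact DFunLike.congr_fun hχ _ }, fun u => ?_⟩
    rw [← hj]
    exact (DFunLike.congr_fun hχ _).trans (IsLocalization.lift_eq hunit u)
  obtain rfl : a = fun i => φ ⟨z i, z_mem k z δ η i⟩ := funext fun i => by
    simpa using (hφ (.X i)).symm
  have hφH : φ ∈ Hset k kbar z δ η d fs g := by
    refine ⟨by rwa [hφ], fun i => ?_, fun f hf => hirr f hf _ fun i => by simp⟩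
    have := hfin (Finset.Iic i)
    rwa [Fin.card_Iic, Finset.coe_Iic] at this
  exact hha ((hφ h).symm.trans (hI hφH _ hhI))
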